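/- Every finite game has a mixed-strategy Nash equilibrium. Precisely: let there be N players, let each player i have a nonempty finite set of pure strategies A_i, and let u_i : A_1 × ⋯ × A_N → ℝ be player i's payoff function. For mixed strategies σ_j ∈ Δ(A_j) (probability distributions on A_j), define the expected payoff U_i(σ_1,…,σ_N) = ∑_{(a_1,…,a_N)} (∏_j σ_j(a_j)) · u_i(a_1,…,a_N). Then there exists a mixed-strategy profile σ* such that for every player i and every mixed strategy σ_i ∈ Δ(A_i), U_i(σ_i, σ*_{-i}) ≤ U_i(σ*_i, σ*_{-i}). -/

import Mathlib

open Function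

/-- A finite set `B` is dominant for a family of orders given by ranks `r i` if no point lies
strictly above the `r i`-minimum of `B` for all `i` simultaneously. -/
def IsDominant {I X α : Type*} [LinearOrder α] (r : I → X → α) (B : Finset X) : Prop :=
  ∀ y, ∃ i, ∀ x ∈ B, r i y ≤ r i x

/-- A set containing `D` and having exactly one more element arises from `D` by insertion. -/
theorem exists_insert_eq_of_card {X : Type*} [DecidableEq X] {D B : Finset X} (h : D ⊆ B)
    (hc : D.card + 1 = B.card) : ∃ x, x ∉ D ∧ insert x D = B := by
  obtain ⟨x, hx⟩ := Finset.card_eq_one.1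
    (show (B \ D).card = 1 by rw [Finset.card_sdiff_of_subset h]; omega)
  have hx' : x ∈ B \ D := hx ▸ Finset.mem_singleton_self x
  refine ⟨x, (Finset.mem_sdiff.1 hx').2, ?_⟩
  rw [Finset.insert_eq, ← hx, Finset.sdiff_union_of_subset h]

/-- A set of full size that is not rainbow contains an even number of subsets of codimension one
using exactly the colours different from `i₀`. -/
theorem even_card_rainbow_facets {I X : Type*} [Fintype I] [Fintype X]
    [DecidableEq I] [DecidableEq X] (c : X → I) (i₀ : I) (B : Finset X)
    (hB : B.card = Fintype.card I) (hc : B.image c ≠ Finset.univ) :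
    Even ((Finset.univ.filter fun D : Finset X =>
      D.card + 1 = Fintype.card I ∧ D.image c = Finset.univ.erase i₀).filter
        fun D => D ⊆ B).card := by
  classical
  rcases Finset.eq_empty_or_nonempty ((Finset.univ.filter fun D : Finset X =>
      D.card + 1 = Fintype.card I ∧ D.image c = Finset.univ.erase i₀).filter
        fun D => D ⊆ B) with h | ⟨D, hD⟩
  · simp [h]
  simp only [Finset.mem_filter, Finset.mem_univ, true_and] at hD
  obtain ⟨⟨hDc, hDi⟩, hDB⟩ := hD
  have hinj : Set.InjOn c D := by
    rw [← Finset.card_image_iff, hDi, Finset.card_erase_of_mem (Finset.mem_univ _),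
      Finset.card_univ]
    omega
  obtain ⟨x, hxD, rfl⟩ : ∃ x, x ∉ D ∧ insert x D = B := by
    exact exists_insert_eq_of_card hDB (by omega)
  have hcx : c x ≠ i₀ := by
    intro h
    apply hc
    rw [Finset.image_insert, hDi, h, Finset.insert_erase (Finset.mem_univ _)]
  obtain ⟨d, hdD, hdx⟩ : ∃ d ∈ D, c d = c x := by
    have : c x ∈ D.image c := by rw [hDi]; simp [hcx]
    simpa using this
  have hxd : x ≠ d := fun h => hxD (h ▸ hdD)
  suffices h : ((Finset.univ.filter fun D : Finset X =>
      D.card + 1 = Fintype.card I ∧ D.image c = Finset.univ.erase i₀).filter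
        fun D' => D' ⊆ insert x D) = {D, (insert x D).erase d} by
    rw [h, Finset.card_pair]
    · exact even_two
    · intro h
      rw [h] at hdD
      simp at hdD
  ext D'
  simp only [Finset.mem_filter, Finset.mem_univ, true_and, Finset.mem_insert,
    Finset.mem_singleton]
  constructor
  · rintro ⟨⟨h1, h2⟩, h3⟩
    obtain ⟨x', hx', hx'D⟩ : ∃ x', x' ∉ D' ∧ insert x' D' = insert x D := by
      exact exists_insert_eq_of_card h3 (by omega)
    have hD' : D' = (insert x D).erase x' := by
      rw [← hx'D, Finset.erase_insert hx']
    by_cases hxx : x' = x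
    · left; rw [hD', hxx, Finset.erase_insert hxD]
    right
    have hx'mem : x' ∈ D := by
      have : x' ∈ insert x D := hx'D ▸ Finset.mem_insert_self _ _
      exact (Finset.mem_insert.1 this).resolve_left hxx
    have : c x' ∈ D'.image c := by
      rw [h2, ← hDi]; exact Finset.mem_image_of_mem _ hx'mem
    obtain ⟨z, hz, hzc⟩ := Finset.mem_image.1 this
    have hzx : z = x := by
      by_contra hne
      have : z ∈ D := (Finset.mem_insert.1 (h3 hz)).resolve_left hne
      exact hx' (hinj this hx'mem hzc ▸ hz)
    have : x' = d := hinj hx'mem hdD (by rw [← hzc, hzx, hdx])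
    rw [hD', this]
  · rintro (rfl | rfl)
    · exact ⟨⟨hDc, hDi⟩, Finset.subset_insert _ _⟩
    · refine ⟨⟨?_, ?_⟩, Finset.erase_subset _ _⟩
      · rw [Finset.card_erase_of_mem (by simp [hdD]), Finset.card_insert_of_notMem hxD]
        omega
      · rw [← hDi]
        ext j
        simp only [Finset.mem_image, Finset.mem_erase, Finset.mem_insert]
        constructor
        · rintro ⟨a, ⟨_, rfl | h⟩, rfl⟩
          · exact ⟨d, hdD, hdx⟩
          · exact ⟨a, h, rfl⟩
        · rintro ⟨a, h, rfl⟩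
          by_cases had : a = d
          · exact ⟨x, ⟨hxd, Or.inl rfl⟩, by rw [had, hdx]⟩
          · exact ⟨a, ⟨had, Or.inr h⟩, rfl⟩

/-- The supersets with one more element, described by the added element. -/
theorem card_filter_superset_eq {X : Type*} [Fintype X] [DecidableEq X] (D : Finset X) (n : ℕ)
    (hn : D.card + 1 = n) (P : Finset X → Prop) [DecidablePred P] :
    ((Finset.univ.filter fun B : Finset X => B.card = n ∧ P B).filter fun B => D ⊆ B).card =
      (Finset.univ.filter fun y => y ∉ D ∧ P (insert y D)).card := by
  symm
  apply Finset.card_bij (fun y _ => insert y D)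
  · intro y hy
    simp only [Finset.mem_filter, Finset.mem_univ, true_and] at hy ⊢
    exact ⟨⟨by rw [Finset.card_insert_of_notMem hy.1, hn], hy.2⟩, Finset.subset_insert _ _⟩
  · intro y hy z hz h
    simp only [Finset.mem_filter, Finset.mem_univ, true_and] at hy hz
    have : y ∈ insert z D := h ▸ Finset.mem_insert_self _ _
    exact (Finset.mem_insert.1 this).resolve_right hy.1
  · intro B hB
    simp only [Finset.mem_filter, Finset.mem_univ, true_and] at hB
    obtain ⟨⟨h1, h2⟩, h3⟩ := hB
    obtain ⟨a, h1, h2⟩ := exists_insert_eq_of_card h3 (by omega)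
    subst h2
    exact ⟨a, by simp_all, rfl⟩

/-- A codimension-one set with a non-slack element has zero or two dominant extensions. -/
theorem even_card_dominant_insert {I X α : Type*} [Fintype I] [Fintype X] [DecidableEq X]
    [LinearOrder α] (r : I → X → α) (hr : ∀ i, Injective (r i)) (s : I → X)
    (hs : ∀ i j x, i ≠ j → x ∉ Set.range s → r i x < r i (s j))
    (D : Finset X) (hD : D.card + 1 = Fintype.card I) (t : X) (htD : t ∈ D)
    (ht : t ∉ Set.range s) [DecidablePred (IsDominant r)] :
    Even (Finset.univ.filter fun y => y ∉ D ∧ IsDominant r (insert y D)).card := by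
  classical
  rcases Finset.eq_empty_or_nonempty
    (Finset.univ.filter fun y => y ∉ D ∧ IsDominant r (insert y D)) with h | ⟨y₀, hy₀⟩
  · simp [h]
  simp only [Finset.mem_filter, Finset.mem_univ, true_and] at hy₀
  have hdom : IsDominant r D := fun y => (hy₀.2 y).imp fun i hi x hx =>
    hi x (Finset.mem_insert_of_mem hx)
  have hmin : ∀ i, ∃ m ∈ D, ∀ x ∈ D, r i m ≤ r i x := fun i =>
    Finset.exists_min_image D (r i) ⟨t, htD⟩
  choose m hmD hm using hmin
  have hsurj : ∀ x ∈ D, ∃ i, m i = x := fun x hx => by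
    obtain ⟨i, hi⟩ := hdom x
    exact ⟨i, hr i (le_antisymm (hm i x hx) (hi _ (hmD i)))⟩
  have hinj : ∀ i, (∀ x ∈ D, ∃ j, j ≠ i ∧ m j = x) →
      ∀ j k, j ≠ i → k ≠ i → m j = m k → j = k := by
    intro i hi j k hj hk hjk
    have himg : (Finset.univ.erase i).image m = D := by
      ext x
      simp only [Finset.mem_image, Finset.mem_erase, Finset.mem_univ, and_true]
      exact ⟨fun ⟨j, _, h⟩ => h ▸ hmD j, fun hx => hi x hx⟩
    have : Set.InjOn m (Finset.univ.erase i : Finset I) := by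
      rw [← Finset.card_image_iff, himg, Finset.card_erase_of_mem (Finset.mem_univ _),
        Finset.card_univ]
      omega
    exact this (by simp [hj]) (by simp [hk]) hjk
  obtain ⟨i₁, i₂, hne, hcol⟩ : ∃ i₁ i₂, i₁ ≠ i₂ ∧ m i₁ = m i₂ := by
    obtain ⟨a, _, b, _, h1, h2⟩ := Finset.exists_ne_map_eq_of_card_lt_of_maps_to
      (s := Finset.univ) (t := D) (f := m) (by rw [Finset.card_univ]; omega)
      (fun i _ => hmD i)
    exact ⟨a, b, h1, h2⟩
  have hoff : ∀ i, (∀ x ∈ D, ∃ j, j ≠ i ∧ m j = x) ↔ i = i₁ ∨ i = i₂ := by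
    intro i
    constructor
    · intro h
      by_contra! hcon
      exact hne (hinj i h _ _ hcon.1.symm hcon.2.symm hcol)
    · rintro (rfl | rfl) x hx <;> obtain ⟨j, hj⟩ := hsurj x hx
      · by_cases h : j = i
        · exact ⟨i₂, hne.symm, by rw [← hcol, ← h, hj]⟩
        · exact ⟨j, h, hj⟩
      · by_cases h : j = i
        · exact ⟨i₁, hne, by rw [hcol, ← h, hj]⟩
        · exact ⟨j, h, hj⟩
  have hmax : ∀ i, ∃ y, (∀ j, j ≠ i → r j (m j) < r j y) ∧
      ∀ z, (∀ j, j ≠ i → r j (m j) < r j z) → r i z ≤ r i y := by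
    intro i
    obtain ⟨y, hy, hy'⟩ := Finset.exists_max_image
      (Finset.univ.filter fun y => ∀ j, j ≠ i → r j (m j) < r j y) (r i)
      ⟨s i, by
        simp only [Finset.mem_filter, Finset.mem_univ, true_and]
        exact fun j hj => (hm j t htD).trans_lt (hs j i t hj ht)⟩
    simp only [Finset.mem_filter, Finset.mem_univ, true_and] at hy hy'
    exact ⟨y, hy, hy'⟩
  choose p hp hpmax using hmax
  have hpD : ∀ i, (i = i₁ ∨ i = i₂) → p i ∉ D := by
    intro i hi h
    obtain ⟨j, hj, hjp⟩ := (hoff i).2 hi _ h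
    have := hp i j hj
    rw [hjp] at this
    exact lt_irrefl _ this
  have hpdom : ∀ i, (i = i₁ ∨ i = i₂) → IsDominant r (insert (p i) D) := by
    intro i hi z
    by_cases hz : ∀ j, j ≠ i → r j (m j) < r j z
    · refine ⟨i, fun x hx => ?_⟩
      rcases Finset.mem_insert.1 hx with rfl | hx
      · exact hpmax i z hz
      · obtain ⟨j, hj⟩ := hdom z
        by_cases hji : j = i
        · exact hji ▸ hj x (by simpa using hx)
        · exact absurd (hj _ (hmD j)) (not_le.2 (hz j hji))
    · push Not at hz
      obtain ⟨j, hji, hj⟩ := hz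
      refine ⟨j, fun x hx => ?_⟩
      rcases Finset.mem_insert.1 hx with rfl | hx
      · exact hj.trans (hp i j hji).le
      · exact hj.trans (hm j x hx)
  suffices h : (Finset.univ.filter fun y => y ∉ D ∧ IsDominant r (insert y D)) =
      {p i₁, p i₂} by
    rw [h, Finset.card_pair]
    · exact even_two
    · intro h
      obtain ⟨j, hj⟩ := hdom (p i₁)
      refine absurd (hj _ (hmD j)) (not_le.2 ?_)
      by_cases hji : j = i₁
      · rw [h]; exact hp i₂ j (hji ▸ hne)
      · exact hp i₁ j hji
  ext y
  simp only [Finset.mem_filter, Finset.mem_univ, true_and, Finset.mem_insert,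
    Finset.mem_singleton]
  constructor
  · rintro ⟨hyD, hy⟩
    obtain ⟨i, hi⟩ := hy y
    have hj : ∀ x ∈ D, ∃ j, j ≠ i ∧ m j = x ∧ r j x ≤ r j y := by
      intro x hx
      obtain ⟨j, hj⟩ := hy x
      refine ⟨j, ?_, ?_, hj y (Finset.mem_insert_self _ _)⟩
      · rintro rfl
        have := hr j (le_antisymm (hj y (Finset.mem_insert_self _ _))
          (hi x (Finset.mem_insert_of_mem hx)))
        exact hyD (this ▸ hx)
      · exact hr j (le_antisymm (hm j x hx) (hj _ (Finset.mem_insert_of_mem (hmD j))))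
    have hsur : ∀ x ∈ D, ∃ j, j ≠ i ∧ m j = x := fun x hx =>
      (hj x hx).imp fun j h => ⟨h.1, h.2.1⟩
    have hN : ∀ j, j ≠ i → r j (m j) < r j y := by
      intro j hji
      obtain ⟨k, hki, hkm, hk⟩ := hj (m j) (hmD j)
      obtain rfl := hinj i hsur k j hki hji hkm
      exact lt_of_le_of_ne hk fun h => hyD (hr k h ▸ hmD k)
    have hyp : y = p i := by
      refine hr i (le_antisymm (hpmax i y hN) ?_)
      obtain ⟨j, hj⟩ := hy (p i)
      by_cases hji : j = i
      · exact hji ▸ hj y (Finset.mem_insert_self _ _)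
      · exact absurd (hj _ (Finset.mem_insert_of_mem (hmD j))) (not_le.2 (hp i j hji))
    rcases (hoff i).1 hsur with rfl | rfl
    · exact Or.inl hyp
    · exact Or.inr hyp
  · rintro (rfl | rfl)
    · exact ⟨hpD _ (Or.inl rfl), hpdom _ (Or.inl rfl)⟩
    · exact ⟨hpD _ (Or.inr rfl), hpdom _ (Or.inr rfl)⟩

/-- The facet consisting of all slack elements but one has a unique dominant extension. -/
theorem card_dominant_insert_slack {I X α : Type*} [Fintype I] [DecidableEq I] [Fintype X]
    [DecidableEq X] [LinearOrder α] (r : I → X → α) (hr : ∀ i, Injective (r i)) (s : I → X)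
    (hs₀ : ∀ i x, r i (s i) ≤ r i x)
    (hs : ∀ i j x, i ≠ j → x ∉ Set.range s → r i x < r i (s j))
    (hX : ∃ x, x ∉ Set.range s) (i₀ : I) [DecidablePred (IsDominant r)] :
    (Finset.univ.filter fun y => y ∉ (Finset.univ.erase i₀).image s ∧
      IsDominant r (insert y ((Finset.univ.erase i₀).image s))).card = 1 := by
  classical
  obtain ⟨p, hp, hpmax⟩ := Finset.exists_max_image
    (Finset.univ.filter fun x => x ∉ Set.range s) (r i₀) (by
      obtain ⟨x, hx⟩ := hX
      exact ⟨x, by simpa using hx⟩)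
  simp only [Finset.mem_filter, Finset.mem_univ, true_and] at hp hpmax
  have key : ∀ i z, z ∉ Set.range s → ¬ r i z ≤ r i (s i) := fun i z hz h =>
    hz ⟨i, hr i (le_antisymm (hs₀ i z) h)⟩
  rw [Finset.card_eq_one]
  refine ⟨p, ?_⟩
  ext y
  simp only [Finset.mem_filter, Finset.mem_univ, true_and, Finset.mem_singleton]
  constructor
  · rintro ⟨hyD, hy⟩
    have hmem : ∀ i, i ≠ i₀ → s i ∈ insert y ((Finset.univ.erase i₀).image s) := fun i hi =>
      Finset.mem_insert_of_mem (Finset.mem_image_of_mem _ (by simp [hi]))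
    obtain ⟨i, hi⟩ := hy p
    obtain rfl : i = i₀ := by
      by_contra h
      exact key i p hp (hi _ (hmem i h))
    have hpy := hi y (Finset.mem_insert_self _ _)
    refine hr i (le_antisymm (hpmax y ?_) hpy)
    rintro ⟨j, rfl⟩
    by_cases hj : j = i
    · subst hj
      exact key j p hp hpy
    · exact hyD (Finset.mem_image_of_mem _ (by simp [hj]))
  · rintro rfl
    refine ⟨fun h => ?_, fun z => ?_⟩
    · obtain ⟨j, _, hj⟩ := Finset.mem_image.1 h
      exact hp ⟨j, hj⟩
    · by_cases hz : z ∈ Set.range s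
      · obtain ⟨j, rfl⟩ := hz
        exact ⟨j, fun x _ => hs₀ j x⟩
      · refine ⟨i₀, fun x hx => ?_⟩
        rcases Finset.mem_insert.1 hx with rfl | hx
        · exact hpmax z hz
        · obtain ⟨j, hj, rfl⟩ := Finset.mem_image.1 hx
          exact (hs i₀ j z (Finset.ne_of_mem_erase hj).symm hz).le

/-- **Scarf's lemma**: every colouring has a rainbow dominant set. -/
theorem exists_dominant_rainbow {I X α : Type*} [Fintype I] [DecidableEq I] [Nonempty I]
    [Fintype X] [LinearOrder α] (r : I → X → α) (hr : ∀ i, Injective (r i)) (s : I → X)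
    (hs₀ : ∀ i x, r i (s i) ≤ r i x)
    (hs : ∀ i j x, i ≠ j → x ∉ Set.range s → r i x < r i (s j))
    (hX : ∃ x, x ∉ Set.range s) (c : X → I) (hc : ∀ i, c (s i) = i) :
    ∃ B : Finset X, IsDominant r B ∧ B.image c = Finset.univ := by
  classical
  by_contra! hcon
  let i₀ : I := Classical.arbitrary I
  let doors := Finset.univ.filter fun D : Finset X =>
      D.card + 1 = Fintype.card I ∧ D.image c = Finset.univ.erase i₀
  let rooms := Finset.univ.filter fun B : Finset X =>
      B.card = Fintype.card I ∧ IsDominant r B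
  let D₀ := (Finset.univ.erase i₀).image s
  have hsinj : Injective s := fun a b h => by rw [← hc a, h, hc]
  have hD₀ : D₀ ∈ doors := by
    simp only [doors, D₀, Finset.mem_filter, Finset.mem_univ, true_and]
    refine ⟨?_, ?_⟩
    · rw [Finset.card_image_of_injective _ hsinj, Finset.card_erase_add_one (Finset.mem_univ _),
        Finset.card_univ]
    · rw [Finset.image_image]
      have : c ∘ s = id := funext hc
      rw [this, Finset.image_id]
  have hcount := Finset.sum_card_bipartiteAbove_eq_sum_card_bipartiteBelow
    (s := doors) (t := rooms) (fun D B => D ⊆ B)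
  have heven : Even (∑ B ∈ rooms, (doors.bipartiteBelow (fun D B => D ⊆ B) B).card) := by
    refine Finset.even_sum _ fun B hB => ?_
    simp only [rooms, Finset.mem_filter, Finset.mem_univ, true_and] at hB
    exact even_card_rainbow_facets c i₀ B hB.1 (hcon B hB.2)
  have habove : ∀ D ∈ doors, (rooms.bipartiteAbove (fun D B => D ⊆ B) D).card =
      (Finset.univ.filter fun y => y ∉ D ∧ IsDominant r (insert y D)).card := by
    intro D hD
    simp only [doors, Finset.mem_filter, Finset.mem_univ, true_and] at hD
    exact card_filter_superset_eq D _ hD.1 _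
  rw [← hcount, ← Finset.add_sum_erase _ _ hD₀, habove _ hD₀,
    card_dominant_insert_slack r hr s hs₀ hs hX i₀] at heven
  have : Even (∑ D ∈ doors.erase D₀, (rooms.bipartiteAbove (fun D B => D ⊆ B) D).card) := by
    refine Finset.even_sum _ fun D hD => ?_
    obtain ⟨hne, hD⟩ := Finset.mem_erase.1 hD
    rw [habove D hD]
    simp only [doors, Finset.mem_filter, Finset.mem_univ, true_and] at hD
    by_cases ht : ∃ t ∈ D, t ∉ Set.range s
    · obtain ⟨t, htD, ht⟩ := ht
      exact even_card_dominant_insert r hr s hs D hD.1 t htD ht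
    · push Not at ht
      refine absurd ?_ hne
      ext x
      simp only [D₀, Finset.mem_image]
      constructor
      · intro hx
        obtain ⟨j, rfl⟩ := ht x hx
        refine ⟨j, ?_, rfl⟩
        rw [← hD.2]
        exact Finset.mem_image.2 ⟨_, hx, hc j⟩
      · rintro ⟨j, hj, rfl⟩
        rw [← hD.2] at hj
        obtain ⟨x, hx, rfl⟩ := Finset.mem_image.1 hj
        obtain ⟨k, rfl⟩ := ht x hx
        rwa [hc]
  obtain ⟨a, ha⟩ := heven
  obtain ⟨b, hb⟩ := this
  omega

/-- Sperner-type consequence of Scarf's lemma on the integer points of a dilated simplex: for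
every colouring, there are points close to one another, the `i`-th of which has colour `i`
unless its `i`-th coordinate is small. -/
theorem exists_close_rainbow_grid {I : Type*} [Fintype I] [Nonempty I] (m : ℕ)
    (c : (I → ℕ) → I) :
    ∃ x₀ : I → ℕ, ∑ i, x₀ i = m ∧ ∀ i, ∃ x : I → ℕ, ∑ j, x j = m ∧
      (∀ j, x j ≤ x₀ j + Fintype.card I ∧ x₀ j ≤ x j + Fintype.card I) ∧
      (c x = i ∨ x i ≤ Fintype.card I) := by
  classical
  let T := {x : I → ℕ // x ∈ Finset.piAntidiag Finset.univ m}
  have hT : ∀ x : I → ℕ, x ∈ Finset.piAntidiag Finset.univ m ↔ ∑ i, x i = m := by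
    intro x; simp [Finset.mem_piAntidiag]
  let w : I → T ⊕ I → ℤ := fun i =>
    Sum.elim (fun x => (x.1 i : ℤ)) fun j => if i = j then -1 else m + 1
  let _ : Fintype T := inferInstanceAs (Fintype (Finset.piAntidiag Finset.univ m))
  let e := Fintype.equivFin (T ⊕ I)
  let r : I → T ⊕ I → ℤ ×ₗ Fin (Fintype.card (T ⊕ I)) := fun i x => toLex (w i x, e x)
  have hle : ∀ i x y, r i x ≤ r i y → w i x ≤ w i y := by
    intro i x y h
    rcases Prod.Lex.toLex_le_toLex.1 h with h | h
    · exact h.le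
    · exact h.1.le
  have hlt : ∀ i x y, w i x < w i y → r i x < r i y := fun i x y h =>
    Prod.Lex.toLex_lt_toLex.2 (Or.inl h)
  have hr : ∀ i, Injective (r i) := by
    intro i x y h
    have h' : (w i x, e x) = (w i y, e y) := toLex.injective h
    exact e.injective (Prod.ext_iff.1 h').2
  have hbound : ∀ (x : T) i, x.1 i ≤ m := fun x i =>
    (Finset.single_le_sum (fun _ _ => Nat.zero_le _) (Finset.mem_univ i)).trans
      ((hT x.1).1 x.2).le
  have hsingle : ∑ j, (Pi.single (Classical.arbitrary I) m : I → ℕ) j = m := by simp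
  let t₀ : T := ⟨_, (hT _).2 hsingle⟩
  obtain ⟨B, hB, hcol⟩ := exists_dominant_rainbow r hr Sum.inr
    (by
      rintro i (x | j)
      · refine (hlt i _ _ ?_).le
        simp only [w, Sum.elim_inl, Sum.elim_inr, if_true]
        omega
      · by_cases h : i = j
        · rw [h]
        · refine (hlt i _ _ ?_).le
          simp only [w, Sum.elim_inr, if_true, if_neg h]
          omega)
    (by
      rintro i j (x | k) hij hx
      · apply hlt
        have := hbound x i
        simp only [w, Sum.elim_inl, Sum.elim_inr, if_neg hij]
        omega
      · exact absurd ⟨k, rfl⟩ hx)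
    ⟨Sum.inl t₀, by simp⟩
    (Sum.elim (fun x => c x.1) id) (fun _ => rfl)
  have hcolour : ∀ i, Sum.inr i ∉ B → ∃ x : T, Sum.inl x ∈ B ∧ c x.1 = i := by
    intro i hi
    obtain ⟨b, hb, hbi⟩ := Finset.mem_image.1 (hcol ▸ Finset.mem_univ i)
    rcases b with x | k
    · exact ⟨x, hb, hbi⟩
    · exact absurd ((show k = i from hbi) ▸ hb) hi
  have hdom : ∀ y : T, ∃ i, Sum.inr i ∉ B ∧ ∀ x : T, Sum.inl x ∈ B → y.1 i ≤ x.1 i := by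
    intro y
    obtain ⟨i, hi⟩ := hB (Sum.inl y)
    refine ⟨i, fun h => ?_, fun x hx => ?_⟩
    · have := hle _ _ _ (hi _ h)
      simp only [w, Sum.elim_inl, Sum.elim_inr, if_true] at this
      omega
    · have := hle _ _ _ (hi _ hx)
      simp only [w, Sum.elim_inl] at this
      omega
  obtain ⟨i₁, hi₁, -⟩ := hdom t₀
  obtain ⟨x₀, hx₀, -⟩ := hcolour i₁ hi₁
  have hmin : ∀ i, ∃ y : T, Sum.inl y ∈ B ∧ ∀ x : T, Sum.inl x ∈ B → y.1 i ≤ x.1 i := by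
    intro i
    obtain ⟨y, hy, hy'⟩ := Finset.exists_min_image
      (Finset.univ.filter fun x : T => Sum.inl x ∈ B) (fun x => x.1 i) ⟨x₀, by simpa using hx₀⟩
    exact ⟨y, by simpa using hy, fun x hx => hy' x (by simpa using hx)⟩
  choose μ hμ hμmin using hmin
  let a : I → ℕ := fun i => if Sum.inr i ∈ B then 0 else (μ i).1 i
  have hsum : m < ∑ i, a i + Fintype.card I := by
    by_contra! hcon
    let b : I → ℕ := fun i => if Sum.inr i ∈ B then 0 else (μ i).1 i + 1
    have hb : ∑ i, b i ≤ m := by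
      refine le_trans ?_ hcon
      rw [← Finset.card_univ, Finset.card_eq_sum_ones, ← Finset.sum_add_distrib]
      refine Finset.sum_le_sum fun i _ => ?_
      simp only [a, b]
      split_ifs <;> omega
    let y : T := ⟨fun i => b i + if i = i₁ then m - ∑ i, b i else 0, (hT _).2 (by
      rw [Finset.sum_add_distrib, Finset.sum_ite_eq' Finset.univ i₁]
      simp only [Finset.mem_univ, if_true]
      omega)⟩
    obtain ⟨i, hi, hiy⟩ := hdom y
    have := hiy (μ i) (hμ i)
    simp only [y, b, if_neg hi] at this
    omega
  have hax : ∀ x : T, Sum.inl x ∈ B → ∀ j, a j ≤ x.1 j := by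
    intro x hx j
    simp only [a]
    split_ifs
    · exact Nat.zero_le _
    · exact hμmin j x hx
  have hxa : ∀ x : T, Sum.inl x ∈ B → ∀ j, x.1 j ≤ a j + Fintype.card I := by
    intro x hx j
    have h1 := (hT x.1).1 x.2
    rw [← Finset.add_sum_erase _ _ (Finset.mem_univ j)] at h1 hsum
    have h2 := Finset.sum_le_sum (s := Finset.univ.erase j) fun i _ => hax x hx i
    omega
  refine ⟨x₀.1, (hT _).1 x₀.2, fun i => ?_⟩
  have hclose : ∀ x : T, Sum.inl x ∈ B →
      ∀ j, x.1 j ≤ x₀.1 j + Fintype.card I ∧ x₀.1 j ≤ x.1 j + Fintype.card I := by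
    intro x hx j
    have h1 := hax x hx j
    have h2 := hxa x hx j
    have h3 := hax x₀ hx₀ j
    have h4 := hxa x₀ hx₀ j
    omega
  by_cases hi : Sum.inr i ∈ B
  · refine ⟨x₀.1, (hT _).1 x₀.2, hclose x₀ hx₀, Or.inr ?_⟩
    have := hxa x₀ hx₀ i
    simpa only [a, if_pos hi, zero_add] using this
  · obtain ⟨x, hx, hxi⟩ := hcolour i hi
    exact ⟨x.1, (hT _).1 x.2, hclose x hx, Or.inl hxi⟩

/-- **Brouwer's fixed point theorem** for the standard simplex. -/
theorem exists_fixedPoint_stdSimplex {I : Type*} [Fintype I] [Nonempty I]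
    (f : (I → ℝ) → I → ℝ) (hf : ContinuousOn f (stdSimplex ℝ I))
    (hmaps : Set.MapsTo f (stdSimplex ℝ I) (stdSimplex ℝ I)) :
    ∃ x ∈ stdSimplex ℝ I, f x = x := by
  classical
  let n : ℝ := Fintype.card I
  let q : ℕ → (I → ℕ) → I → ℝ := fun k x i => x i / ((k : ℝ) + 1)
  have hpos : ∀ k : ℕ, (0 : ℝ) < (k : ℝ) + 1 := fun k => by positivity
  have hq : ∀ k x, ∑ i, x i = k + 1 → q k x ∈ stdSimplex ℝ I := by
    intro k x hx
    refine ⟨fun i => div_nonneg (Nat.cast_nonneg _) (hpos k).le, ?_⟩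
    simp only [q]
    rw [← Finset.sum_div, ← Nat.cast_sum, hx, Nat.cast_add_one, div_self (hpos k).ne']
  have hcol : ∀ k x, ∃ i, ∑ i, x i = k + 1 → q k x i ≤ f (q k x) i := by
    intro k x
    by_cases hx : ∑ i, x i = k + 1
    · obtain ⟨i, -, hi⟩ := Finset.exists_le_of_sum_le (s := Finset.univ) (f := q k x)
        (g := f (q k x)) Finset.univ_nonempty (by rw [(hq k x hx).2, (hmaps (hq k x hx)).2])
      exact ⟨i, fun _ => hi⟩
    · exact ⟨Classical.arbitrary I, fun h => absurd h hx⟩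
  choose c hc using hcol
  choose x₀ hx₀ x hx hclose hcx using fun k => exists_close_rainbow_grid (k + 1) (c k)
  obtain ⟨z, hz, φ, hφ, hlim⟩ := (isCompact_stdSimplex ℝ I).tendsto_subseq
    (fun k => hq k (x₀ k) (hx₀ k))
  have herr : Filter.Tendsto (fun k : ℕ => n / ((φ k : ℝ) + 1)) Filter.atTop (nhds 0) := by
    have := (tendsto_one_div_add_atTop_nhds_zero_nat (𝕜 := ℝ)).const_mul n
    simpa [Function.comp_def, div_eq_mul_inv] using this.comp hφ.tendsto_atTop
  have hxlim : ∀ i, Filter.Tendsto (fun k => q (φ k) (x (φ k) i)) Filter.atTop (nhds z) := by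
    intro i
    rw [tendsto_pi_nhds] at hlim ⊢
    intro j
    have h0 : Filter.Tendsto (fun k => q (φ k) (x (φ k) i) j - q (φ k) (x₀ (φ k)) j)
        Filter.atTop (nhds 0) := by
      refine squeeze_zero_norm (fun k => ?_) herr
      obtain ⟨h1, h2⟩ := hclose (φ k) i j
      have h1' : (x (φ k) i j : ℝ) ≤ x₀ (φ k) j + n := by simp only [n]; exact_mod_cast h1
      have h2' : (x₀ (φ k) j : ℝ) ≤ x (φ k) i j + n := by simp only [n]; exact_mod_cast h2
      simp only [q]
      rw [← sub_div, Real.norm_eq_abs, abs_div, abs_of_pos (hpos _)]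
      exact div_le_div_of_nonneg_right (abs_le.2 ⟨by linarith, by linarith⟩) (hpos _).le
    simpa using h0.add (hlim j)
  have hge : ∀ i, z i ≤ f z i := by
    intro i
    have h1 : Filter.Tendsto (fun k => f (q (φ k) (x (φ k) i))) Filter.atTop (nhds (f z)) :=
      (hf z hz).tendsto.comp (tendsto_nhdsWithin_iff.2
        ⟨hxlim i, Filter.Eventually.of_forall fun k => hq _ _ (hx _ _)⟩)
    have h2 := ((tendsto_pi_nhds.1 (hxlim i)) i).sub herr
    rw [sub_zero] at h2
    refine le_of_tendsto_of_tendsto' h2 (tendsto_pi_nhds.1 h1 i) fun k => ?_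
    rcases hcx (φ k) i with h | h
    · have := hc (φ k) (x (φ k) i) (hx _ _)
      rw [h] at this
      have : 0 ≤ n / ((φ k : ℝ) + 1) := div_nonneg (Nat.cast_nonneg _) (hpos _).le
      linarith
    · have h' : (x (φ k) i i : ℝ) ≤ n := by simp only [n]; exact_mod_cast h
      have h3 := div_le_div_of_nonneg_right h' (hpos (φ k)).le
      have h4 := (hmaps (hq _ _ (hx (φ k) i))).1 i
      simp only [q] at h4 ⊢
      linarith
  refine ⟨z, hz, funext fun i => ?_⟩
  have := (Finset.sum_eq_sum_iff_of_le (s := Finset.univ) fun i _ => hge i).1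
    (by rw [hz.2, (hmaps hz).2])
  exact (this i (Finset.mem_univ i)).symm

/-- Brouwer's fixed point theorem for a nonempty finite product of standard simplices. -/
theorem exists_fixedPoint_pi_stdSimplex {N : ℕ} [NeZero N] {A : Fin N → Type*}
    [∀ j, Fintype (A j)] [∀ j, Nonempty (A j)]
    (g : (∀ j, A j → ℝ) → ∀ j, A j → ℝ) (hg : Continuous g)
    (hmaps : ∀ σ, (∀ j, σ j ∈ stdSimplex ℝ (A j)) → ∀ j, g σ j ∈ stdSimplex ℝ (A j)) :
    ∃ σ, (∀ j, σ j ∈ stdSimplex ℝ (A j)) ∧ g σ = σ := by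
  classical
  have hN : (0 : ℝ) < N := Nat.cast_pos.2 (NeZero.pos N)
  let S : (∀ j, A j → ℝ) → Fin N → ℝ := fun σ j => ∑ a, σ j a
  let ρ : (∀ j, A j → ℝ) → ∀ j, A j → ℝ := fun σ j a =>
    (σ j a + max (1 - S σ j) 0 / Fintype.card (A j)) / max (S σ j) 1
  have hmaxpos : ∀ σ j, 0 < max (S σ j) 1 := fun σ j => lt_max_of_lt_right one_pos
  have hρcont : Continuous ρ := by
    refine continuous_pi fun j => continuous_pi fun a => ?_
    refine Continuous.div ?_ ?_ fun σ => (hmaxpos σ j).ne' <;> simp only [S] <;> fun_prop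
  have hρ : ∀ σ : ∀ j, A j → ℝ, (∀ j a, 0 ≤ σ j a) → ∀ j, ρ σ j ∈ stdSimplex ℝ (A j) := by
    intro σ hσ j
    refine ⟨fun a => div_nonneg (add_nonneg (hσ j a)
      (div_nonneg (le_max_right _ _) (Nat.cast_nonneg _))) (hmaxpos σ j).le, ?_⟩
    have hcard : (Fintype.card (A j) : ℝ) ≠ 0 := Nat.cast_ne_zero.2 Fintype.card_ne_zero
    simp only [ρ]
    rw [← Finset.sum_div, Finset.sum_add_distrib, Finset.sum_const, Finset.card_univ,
      nsmul_eq_mul, mul_div_cancel₀ _ hcard, div_eq_one_iff_eq (hmaxpos σ j).ne']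
    change S σ j + _ = _
    rcases le_total (S σ j) 1 with h | h
    · rw [max_eq_left (by linarith), max_eq_right h]; ring
    · rw [max_eq_right (by linarith), max_eq_left h]; ring
  have hρid : ∀ σ : ∀ j, A j → ℝ, (∀ j, σ j ∈ stdSimplex ℝ (A j)) → ρ σ = σ := by
    intro σ hσ
    funext j a
    have : S σ j = 1 := (hσ j).2
    simp [ρ, this]
  have : Nonempty (Σ j, A j) := ⟨⟨0, Classical.arbitrary _⟩⟩
  let P : ((Σ j, A j) → ℝ) → ∀ j, A j → ℝ := fun x j a => N * x ⟨j, a⟩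
  have hP : Continuous P := by fun_prop
  let f : ((Σ j, A j) → ℝ) → (Σ j, A j) → ℝ := fun x p => g (ρ (P x)) p.1 p.2 / N
  have hPnonneg : ∀ x ∈ stdSimplex ℝ (Σ j, A j), ∀ j a, 0 ≤ P x j a := fun x hx j a =>
    mul_nonneg hN.le (hx.1 _)
  have hf : Continuous f := by
    have hG : Continuous fun x => g (ρ (P x)) := hg.comp (hρcont.comp hP)
    refine continuous_pi fun p => Continuous.div_const ?_ _
    exact (continuous_apply p.2).comp ((continuous_apply p.1).comp hG)
  obtain ⟨x, hx, hfx⟩ := exists_fixedPoint_stdSimplex f hf.continuousOn (by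
    intro x hx
    have hσ := hmaps _ (hρ _ (hPnonneg x hx))
    refine ⟨fun p => div_nonneg ((hσ p.1).1 p.2) hN.le, ?_⟩
    simp only [f]
    rw [← Finset.sum_div, Fintype.sum_sigma]
    simp only [(hσ _).2]
    simp [hN.ne'])
  have hPx : P x = g (ρ (P x)) := by
    funext j a
    have := congrFun hfx ⟨j, a⟩
    simp only [f] at this
    change N * x ⟨j, a⟩ = _
    rw [← this, mul_div_cancel₀ _ hN.ne']
  have hmem : ∀ j, P x j ∈ stdSimplex ℝ (A j) := by
    rw [hPx]; exact hmaps _ (hρ _ (hPnonneg x hx))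
  refine ⟨P x, hmem, ?_⟩
  rw [hρid _ hmem] at hPx
  exact hPx.symm

/-- The expected payoff of player `i` when playing the pure strategy `b` against `σ`. -/
noncomputable def purePayoff {N : ℕ} {A : Fin N → Type*} [∀ j, Fintype (A j)]
    (v : (∀ j, A j) → ℝ) (σ : ∀ j, A j → ℝ) (i : Fin N) (b : A i) : ℝ :=
  open Classical in
  ∑ a : ∀ j, A j, if a i = b then (∏ j ∈ Finset.univ.erase i, σ j (a j)) * v a else 0

/-- The expected payoff of a unilateral deviation is linear in the deviating strategy. -/
theorem sum_update_eq_sum_purePayoff {N : ℕ} {A : Fin N → Type*} [∀ j, Fintype (A j)]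
    (v : (∀ j, A j) → ℝ) (σ : ∀ j, A j → ℝ) (i : Fin N) (τ : A i → ℝ) :
    ∑ a : ∀ j, A j, (∏ j, update σ i τ j (a j)) * v a = ∑ b, τ b * purePayoff v σ i b := by
  classical
  simp only [purePayoff, Finset.mul_sum, mul_ite, mul_zero]
  rw [Finset.sum_comm]
  refine Finset.sum_congr rfl fun a _ => ?_
  rw [Finset.sum_ite_eq Finset.univ (a i), if_pos (Finset.mem_univ _),
    ← Finset.mul_prod_erase _ _ (Finset.mem_univ i), update_self, mul_assoc]
  congr 2
  refine Finset.prod_congr rfl fun j hj => ?_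
  rw [update_of_ne (Finset.ne_of_mem_erase hj)]

theorem continuous_purePayoff {N : ℕ} {A : Fin N → Type*} [∀ j, Fintype (A j)]
    (v : (∀ j, A j) → ℝ) (i : Fin N) (b : A i) :
    Continuous fun σ : ∀ j, A j → ℝ => purePayoff v σ i b := by
  classical
  refine continuous_finsetSum _ fun a _ => ?_
  split_ifs <;> fun_prop

/-- If moving probability weight towards the better replies leaves `p` unchanged, then no reply
improves on the average. -/
theorem le_average_of_excess_proportional {B : Type*} [Fintype B] (p V : B → ℝ)
    (hp : p ∈ stdSimplex ℝ B)
    (h : ∀ b, p b * ∑ d, max 0 (V d - ∑ e, p e * V e) = max 0 (V b - ∑ e, p e * V e)) (b : B) :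
    V b ≤ ∑ e, p e * V e := by
  set U := ∑ e, p e * V e with hU
  have hex : ∃ d, 0 < p d ∧ V d ≤ U := by
    by_contra! hcon
    have hle : ∀ d ∈ Finset.univ, p d * U ≤ p d * V d := fun d _ => by
      rcases (hp.1 d).eq_or_lt with h0 | h0
      · simp [← h0]
      · exact mul_le_mul_of_nonneg_left (hcon d h0).le h0.le
    obtain ⟨d, -, hd⟩ : ∃ d ∈ Finset.univ, 0 < p d :=
      Finset.exists_lt_of_sum_lt (s := Finset.univ) (f := fun _ => (0 : ℝ)) (g := p)
        (by rw [hp.2]; simp)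
    have := Finset.sum_lt_sum hle
      ⟨d, Finset.mem_univ d, mul_lt_mul_of_pos_left (hcon d hd) hd⟩
    rw [← Finset.sum_mul, hp.2, one_mul, ← hU] at this
    exact lt_irrefl _ this
  obtain ⟨d, hd, hdU⟩ := hex
  have hzero := h d
  rw [max_eq_left (sub_nonpos.2 hdU)] at hzero
  have hb := h b
  rw [(mul_eq_zero.1 hzero).resolve_left hd.ne', mul_zero] at hb
  have := le_max_right 0 (V b - U)
  linarith

/-- **Nash's theorem: every finite game has a mixed-strategy Nash equilibrium.**
There are `N` players; player `i` has a nonempty finite set `A i` of pure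
strategies and payoff `u i : (∀ j, A j) → ℝ`. A mixed strategy for player `j`
is a probability distribution on `A j`, i.e. an element of `stdSimplex ℝ (A j)`;
the expected payoff of a mixed profile `σ` for player `i` is
`∑ a, (∏ j, σ j (a j)) * u i a`. There exists a mixed-strategy profile `σ`
such that no player can strictly increase its expected payoff by unilaterally
switching to another mixed strategy. -/
theorem finite_game_has_mixed_nash_equilibrium
    (N : ℕ) (A : Fin N → Type*) [∀ j, Fintype (A j)] [∀ j, Nonempty (A j)]
    (u : Fin N → (∀ j, A j) → ℝ) :
    ∃ σ : ∀ j, A j → ℝ,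
      (∀ j, σ j ∈ stdSimplex ℝ (A j)) ∧
      ∀ i, ∀ τ ∈ stdSimplex ℝ (A i),
        (∑ a : ∀ j, A j, (∏ j, update σ i τ j (a j)) * u i a) ≤
        (∑ a : ∀ j, A j, (∏ j, σ j (a j)) * u i a) := by
  classical
  rcases Nat.eq_zero_or_pos N with rfl | hN
  · exact ⟨fun j => j.elim0, fun j => j.elim0, fun i => i.elim0⟩
  have : NeZero N := ⟨hN.ne'⟩
  let V : (∀ j, A j → ℝ) → ∀ j, A j → ℝ := fun σ j => purePayoff (u j) σ j
  let e : (∀ j, A j → ℝ) → ∀ j, A j → ℝ := fun σ j a => max 0 (V σ j a - ∑ b, σ j b * V σ j b)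
  let g : (∀ j, A j → ℝ) → ∀ j, A j → ℝ := fun σ j a => (σ j a + e σ j a) / (1 + ∑ b, e σ j b)
  have he : ∀ σ j a, 0 ≤ e σ j a := fun σ j a => le_max_left _ _
  have hpos : ∀ σ j, 0 < 1 + ∑ b, e σ j b := fun σ j =>
    add_pos_of_pos_of_nonneg one_pos (Finset.sum_nonneg fun b _ => he σ j b)
  have hV : ∀ j a, Continuous fun σ => V σ j a := fun j a => continuous_purePayoff (u j) j a
  have hecont : ∀ j a, Continuous fun σ => e σ j a := fun j a => by
    simp only [e]
    fun_prop
  have hg : Continuous g := by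
    refine continuous_pi fun j => continuous_pi fun a => ?_
    refine Continuous.div ?_ ?_ fun σ => (hpos σ j).ne' <;> fun_prop
  obtain ⟨σ, hσ, hfix⟩ := exists_fixedPoint_pi_stdSimplex g hg (by
    intro σ hσ j
    refine ⟨fun a => div_nonneg (add_nonneg ((hσ j).1 a) (he σ j a)) (hpos σ j).le, ?_⟩
    simp only [g]
    rw [← Finset.sum_div, Finset.sum_add_distrib, (hσ j).2, div_self (hpos σ j).ne'])
  refine ⟨σ, hσ, fun i τ hτ => ?_⟩
  have hbest := le_average_of_excess_proportional (σ i) (V σ i) (hσ i) (by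
    intro b
    have := congrFun (congrFun hfix i) b
    simp only [g] at this
    rw [div_eq_iff (hpos σ i).ne'] at this
    change σ i b * ∑ d, e σ i d = e σ i b
    linarith)
  have hσi := sum_update_eq_sum_purePayoff (u i) σ i (σ i)
  rw [update_eq_self] at hσi
  rw [hσi, sum_update_eq_sum_purePayoff]
  calc ∑ b, τ b * V σ i b ≤ ∑ b, τ b * ∑ d, σ i d * V σ i d :=
        Finset.sum_le_sum fun b _ => mul_le_mul_of_nonneg_left (hbest b) (hτ.1 b)
    _ = ∑ d, σ i d * V σ i d := by rw [← Finset.sum_mul, hτ.2, one_mul]
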